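/- For every integer d ≥ 1 and every M, T, λ > 0 there exists a constant C = C(d,T,M,λ) > 0 with the following property. Let W, W₀ be C² Z^d-periodic functions with ‖W‖_{C²} ≤ M, ‖W₀‖_{C²} ≤ M and ∫_{[0,1)^d} (W−W₀) = 0, and let ρ_W, ρ_{W₀} be classical solutions on [0,T], smooth (infinitely differentiable) on [0,T]×R^d, of the McKean–Vlasov equations with potentials W, W₀ respectively and common initial probability density φ, such that ρ_{W₀}(t,x) ≥ λ for all (t,x). Then for every 0 < t₀ ≤ T: ∫₀^{t₀} ‖(W−W₀)*ρ_{W₀}(t,·)‖²_{L²([0,1)^d)} dt ≤ C ( ‖ρ_W−ρ_{W₀}‖²_{H¹([0,t₀],H^{−1})} + ‖ρ_W−ρ_{W₀}‖²_{L²([0,t₀],H¹)} ). -/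

import Mathlib

open MeasureTheory Real
noncomputable section

/-- The fundamental domain `[0,1)^d` of the torus `T^d`. -/
def cube (d : ℕ) : Set (Fin d → ℝ) := Set.univ.pi fun _ => Set.Ico (0:ℝ) 1

variable {d : ℕ}

/-- The `i`-th spatial partial derivative of `f` at `x`. -/
def pd (i : Fin d) (f : (Fin d → ℝ) → ℝ) (x : Fin d → ℝ) : ℝ :=
  fderiv ℝ f x (Pi.single i 1)

/-- The Laplacian of `f` at `x`. -/
def lap (f : (Fin d → ℝ) → ℝ) (x : Fin d → ℝ) : ℝ := ∑ i, pd i (pd i f) x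

/-- The divergence of a vector field `F` at `x`. -/
def divg (F : (Fin d → ℝ) → Fin d → ℝ) (x : Fin d → ℝ) : ℝ :=
  ∑ i, pd i (fun y => F y i) x

/-- The squared Euclidean norm of the gradient of `f` at `x`. -/
def gradSq (f : (Fin d → ℝ) → ℝ) (x : Fin d → ℝ) : ℝ := ∑ i, (pd i f x) ^ 2

/-- Convolution on the torus: `(f*g)(x) = ∫_{[0,1)^d} f(x-y) g(y) dy`. -/
def pconv (f g : (Fin d → ℝ) → ℝ) (x : Fin d → ℝ) : ℝ :=
  ∫ y in cube d, f (x - y) * g y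

/-- `ℤ^d`-periodicity of a function on `ℝ^d`. -/
def ZdPeriodic (f : (Fin d → ℝ) → ℝ) : Prop :=
  ∀ (x : Fin d → ℝ) (k : Fin d → ℤ), f (x + fun i => (k i : ℝ)) = f x

/-- A probability density on the torus: nonnegative, periodic, integral one over `[0,1)^d`. -/
def IsProbDensity (f : (Fin d → ℝ) → ℝ) : Prop :=
  ZdPeriodic f ∧ (∀ x, 0 ≤ f x) ∧ (∫ x in cube d, f x) = 1

/-- `‖W‖_{C²} ≤ M`: sup-norm bounds on `W` and all its partial derivatives up to order two. -/
def C2NormLE (W : (Fin d → ℝ) → ℝ) (M : ℝ) : Prop :=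
  ∀ x, |W x| ≤ M ∧ (∀ i, |pd i W x| ≤ M) ∧ (∀ i j, |pd i (pd j W) x| ≤ M)

/-- A classical solution on `[0,T]` of the McKean–Vlasov equation
`∂ρ/∂t = Δρ + ∇·(ρ ∇(W*ρ))` with initial condition `φ`:
periodic in space, `C¹` in time, `C²` in space, a probability density at each time. -/
def IsMVSolution (T : ℝ) (W φ : (Fin d → ℝ) → ℝ) (ρ : ℝ → (Fin d → ℝ) → ℝ) : Prop :=
  (∀ t ∈ Set.Icc (0:ℝ) T, ZdPeriodic (ρ t)) ∧
  (∀ x, ContDiffOn ℝ 1 (fun t => ρ t x) (Set.Icc (0:ℝ) T)) ∧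
  (∀ t ∈ Set.Icc (0:ℝ) T, ContDiff ℝ 2 (ρ t)) ∧
  ρ 0 = φ ∧
  (∀ t ∈ Set.Icc (0:ℝ) T, IsProbDensity (ρ t)) ∧
  (∀ t ∈ Set.Icc (0:ℝ) T, ∀ x, deriv (fun s => ρ s x) t =
    lap (ρ t) x + divg (fun y i => ρ t y * pd i (pconv W (ρ t)) y) x)

/-- Relative entropy `H(p|q) = ∫_{[0,1)^d} p log(p/q)`. -/
def relEnt (p q : (Fin d → ℝ) → ℝ) : ℝ :=
  ∫ x in cube d, p x * Real.log (p x / q x)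

/-- The `k`-th Fourier coefficient of a periodic function `f`. -/
def fCoeff (f : (Fin d → ℝ) → ℝ) (k : Fin d → ℤ) : ℂ :=
  ∫ x in cube d, (f x : ℂ) *
    Complex.exp (-(Complex.ofReal (2 * Real.pi) * Complex.I *
      Complex.ofReal (∑ i, (k i : ℝ) * x i)))

/-- Squared Euclidean norm `|k|²` of a frequency `k ∈ ℤ^d`. -/
def kSq (k : Fin d → ℤ) : ℝ := ∑ i, ((k i : ℝ)) ^ 2

/-- Squared Sobolev norm of order `s`: `‖f‖²_{H^s} = Σ_k (1+|k|²)^s |f̂(k)|²`. -/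
def sobSq (s : ℝ) (f : (Fin d → ℝ) → ℝ) : ℝ :=
  ∑' k : Fin d → ℤ, (1 + kSq k) ^ s * ‖fCoeff f k‖ ^ 2

lemma measurableSet_cube : MeasurableSet (cube d) :=
  MeasurableSet.univ_pi fun _ => measurableSet_Ico

lemma cube_ae_eq_Icc : cube d =ᵐ[volume] Set.Icc (0 : Fin d → ℝ) 1 :=
  Measure.univ_pi_Ico_ae_eq_Icc (μ := fun _ => (volume : Measure ℝ)) (f := 0) (g := 1)

lemma restrict_cube :
    (volume.restrict (cube d)) = volume.restrict (Set.Icc (0 : Fin d → ℝ) 1) :=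
  Measure.restrict_congr_set cube_ae_eq_Icc

lemma volume_cube : volume (cube d) = 1 := by
  simp [cube, volume_pi_pi]

instance isProbabilityMeasure_restrict_cube :
    IsProbabilityMeasure ((volume : Measure (Fin d → ℝ)).restrict (cube d)) :=
  ⟨by simp [volume_cube]⟩

lemma Continuous.integrableOn_cube {E : Type*} [NormedAddCommGroup E]
    {f : (Fin d → ℝ) → E} (hf : Continuous f) : IntegrableOn f (cube d) := by
  rw [IntegrableOn, restrict_cube]
  exact hf.continuousOn.integrableOn_compact isCompact_Icc

section Parseval

local instance : MeasureSpace UnitAddCircle := ⟨AddCircle.haarAddCircle⟩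

open ComplexConjugate UnitAddTorus

/-- The function on the torus that agrees with `f` on the fundamental domain `(0,1]^d`. -/
def torusLift (f : (Fin d → ℝ) → ℝ) (p : UnitAddTorus (Fin d)) : ℂ :=
  f fun i => (AddCircle.measurableEquivIoc 1 0 (p i) : ℝ)

lemma torusLift_coe (f : (Fin d → ℝ) → ℝ) {x : Fin d → ℝ}
    (hx : x ∈ {x : Fin d → ℝ | ∀ i, x i ∈ Set.Ioc ((0 : Fin d → ℝ) i) ((0 : Fin d → ℝ) i + 1)}) :
    torusLift f (fun i => (x i : UnitAddCircle)) = f x := by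
  unfold torusLift
  congr 2
  ext i
  exact AddCircle.equivIoc_coe_of_mem (p := 1) (a := 0) (hx i)

lemma setOf_Ioc_ae_eq_cube :
    {x : Fin d → ℝ | ∀ i, x i ∈ Set.Ioc ((0 : Fin d → ℝ) i) ((0 : Fin d → ℝ) i + 1)}
      =ᵐ[volume] cube d := by
  refine Filter.EventuallyEq.trans ?_ cube_ae_eq_Icc.symm
  have := Measure.univ_pi_Ioc_ae_eq_Icc (μ := fun _ : Fin d => (volume : Measure ℝ))
    (f := 0) (g := 1)
  simp only [Pi.zero_apply, Pi.one_apply, Set.pi, Set.mem_univ, true_imp_iff] at this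
  simpa only [Pi.zero_apply, zero_add] using! this

lemma setIntegral_Ioc_eq_cube {E : Type*} [NormedAddCommGroup E] [NormedSpace ℝ E]
    {F : (Fin d → ℝ) → E} {G : (Fin d → ℝ) → E}
    (h : ∀ x ∈ {x : Fin d → ℝ | ∀ i, x i ∈ Set.Ioc ((0 : Fin d → ℝ) i) ((0 : Fin d → ℝ) i + 1)},
      F x = G x) :
    ∫ x in {x : Fin d → ℝ | ∀ i, x i ∈ Set.Ioc ((0 : Fin d → ℝ) i) ((0 : Fin d → ℝ) i + 1)}, F x
      = ∫ x in cube d, G x := by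
  rw [setIntegral_congr_fun (MeasurableSet.univ_pi' fun i => measurableSet_Ioc) h]
  exact setIntegral_congr_set setOf_Ioc_ae_eq_cube

lemma memLp_torusLift {f : (Fin d → ℝ) → ℝ} (hf : Continuous f) :
    MemLp (torusLift f) 2 (volume : Measure (UnitAddTorus (Fin d))) := by
  obtain ⟨C, hC⟩ := (isCompact_Icc (a := (0 : Fin d → ℝ)) (b := 1)).exists_bound_of_continuousOn
    hf.continuousOn
  have hm : Measurable (torusLift f) := by
    unfold torusLift
    refine Complex.measurable_ofReal.comp (hf.measurable.comp (measurable_pi_lambda _ fun i => ?_))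
    exact measurable_subtype_coe.comp
      ((AddCircle.measurableEquivIoc 1 0).measurable.comp (measurable_pi_apply i))
  have : IsProbabilityMeasure (volume : Measure UnitAddCircle) :=
    inferInstanceAs (IsProbabilityMeasure AddCircle.haarAddCircle)
  refine MemLp.of_bound hm.aestronglyMeasurable C (Filter.Eventually.of_forall fun p => ?_)
  rw [torusLift, Complex.norm_real]
  refine hC _ ⟨fun i => ?_, fun i => ?_⟩
  · exact (AddCircle.measurableEquivIoc 1 0 (p i)).2.1.le
  · simpa using (AddCircle.measurableEquivIoc 1 0 (p i)).2.2

lemma mFourier_neg_coe (k : Fin d → ℤ) (x : Fin d → ℝ) :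
    mFourier (-k) (fun i => (x i : UnitAddCircle)) =
      Complex.exp (-(Complex.ofReal (2 * Real.pi) * Complex.I *
      Complex.ofReal (∑ i, (k i : ℝ) * x i))) := by
  simp only [mFourier, ContinuousMap.coe_mk, fourier_coe_apply, ← Complex.exp_sum]
  congr 1
  push_cast
  rw [Finset.mul_sum, ← Finset.sum_neg_distrib]
  refine Finset.sum_congr rfl fun i _ => ?_
  simp
  ring

lemma mFourierCoeff_torusLift (f : (Fin d → ℝ) → ℝ) (k : Fin d → ℤ) :
    mFourierCoeff (torusLift f) k = fCoeff f k := by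
  rw [mFourierCoeff_eq_integral _ _ 0]
  refine setIntegral_Ioc_eq_cube fun x hx => ?_
  rw [torusLift_coe f hx, mFourier_neg_coe, smul_eq_mul, mul_comm]

/-- Parseval's identity for real continuous functions on the unit cube. -/
lemma hasSum_fCoeff_mul {f g : (Fin d → ℝ) → ℝ} (hf : Continuous f) (hg : Continuous g) :
    HasSum (fun k => conj (fCoeff f k) * fCoeff g k)
      ((∫ x in cube d, f x * g x : ℝ) : ℂ) := by
  have h := hasSum_prod_mFourierCoeff (memLp_torusLift hf).toLp (memLp_torusLift hg).toLp
  have hco : ∀ {f : (Fin d → ℝ) → ℝ} (hf : Continuous f) (k : Fin d → ℤ),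
      mFourierCoeff ((memLp_torusLift hf).toLp : UnitAddTorus (Fin d) → ℂ) k = fCoeff f k := by
    intro f hf k
    rw [← mFourierCoeff_torusLift]
    refine integral_congr_ae ?_
    filter_upwards [(memLp_torusLift hf).coeFn_toLp] with p hp
    rw [hp]
  have h' : HasSum (fun k => conj (fCoeff f k) * fCoeff g k) _ :=
    HasSum.congr_fun h fun k =>
      (congrArg₂ (fun a b : ℂ => conj a * b) (hco hf k) (hco hg k)).symm
  convert! h' using 1
  have : ∫ t, conj (((memLp_torusLift hf).toLp : UnitAddTorus (Fin d) → ℂ) t) *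
      ((memLp_torusLift hg).toLp : UnitAddTorus (Fin d) → ℂ) t
      = ∫ t, conj (torusLift f t) * torusLift g t := by
    refine integral_congr_ae ?_
    filter_upwards [(memLp_torusLift hf).coeFn_toLp, (memLp_torusLift hg).coeFn_toLp] with p hp hq
    rw [hp, hq]
  rw [this, integral_preimage _ 0, ← integral_complex_ofReal]
  refine (setIntegral_Ioc_eq_cube fun x hx => ?_).symm
  rw [torusLift_coe f hx, torusLift_coe g hx]
  simp

end Parseval

lemma hasSum_sq_fCoeff {f : (Fin d → ℝ) → ℝ} (hf : Continuous f) :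
    HasSum (fun k => ‖fCoeff f k‖ ^ 2) (∫ x in cube d, f x ^ 2) := by
  have h := Complex.hasSum_re (hasSum_fCoeff_mul hf hf)
  convert h using 1
  · ext k
    rw [mul_comm, Complex.mul_conj, Complex.normSq_eq_norm_sq, Complex.ofReal_re]
  · simp [sq]

lemma integral_cube_fderiv_eq_zero {E : Type*} [NormedAddCommGroup E] [NormedSpace ℝ E]
    {F : (Fin d → ℝ) → E} (hF : ContDiff ℝ 1 F)
    (hper : ∀ (x : Fin d → ℝ) (k : Fin d → ℤ), F (x + fun i => (k i : ℝ)) = F x) (i : Fin d) :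
    ∫ x in cube d, fderiv ℝ F x (Pi.single i 1) = 0 := by
  obtain _ | n := d
  · exact i.elim0
  have hsum : ∀ x, (∑ j, (if j = i then fderiv ℝ F x else 0) (Pi.single j 1))
      = fderiv ℝ F x (Pi.single i 1) := fun x => by
    rw [Finset.sum_eq_single i (fun j _ hj => by simp [hj]) (by simp)]
    simp
  have hcont : Continuous fun x => fderiv ℝ F x (Pi.single i 1) :=
    (hF.continuous_fderiv one_ne_zero).clm_apply continuous_const
  have h := integral_divergence_of_hasFDerivAt_off_countable' (0 : Fin (n + 1) → ℝ) 1
    zero_le_one (fun j x => if j = i then F x else 0)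
    (fun j x => if j = i then fderiv ℝ F x else 0) ∅ Set.countable_empty
    (fun j => by
      split_ifs
      exacts [hF.continuous.continuousOn, continuousOn_const])
    (fun x _ j => by
      split_ifs
      exacts [(hF.differentiable one_ne_zero x).hasFDerivAt, hasFDerivAt_const _ _])
    (by
      simp only [hsum]
      exact hcont.continuousOn.integrableOn_compact isCompact_Icc)
  simp only [hsum] at h
  rw [restrict_cube, h]
  refine Finset.sum_eq_zero fun j _ => sub_eq_zero.2 ?_
  refine integral_congr_ae (Filter.Eventually.of_forall fun x => ?_)
  by_cases hj : j = i
  · subst hj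
    simp only [if_true]
    rw [← hper (j.insertNth ((0 : Fin (n + 1) → ℝ) j) x) (Pi.single j 1)]
    congr 1
    ext l
    refine Fin.succAboveCases j ?_ (fun l => ?_) l
    · simp
    · simp [Fin.succAbove_ne]
  · simp [hj]

lemma Continuous.pd {f : (Fin d → ℝ) → ℝ} (hf : ContDiff ℝ 1 f) (i : Fin d) :
    Continuous (pd i f) :=
  (hf.continuous_fderiv one_ne_zero).clm_apply continuous_const

lemma ContDiff.pd {f : (Fin d → ℝ) → ℝ} (hf : ContDiff ℝ 2 f) (i : Fin d) :
    ContDiff ℝ 1 (pd i f) :=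
  (hf.fderiv_right (m := 1) (by norm_num)).clm_apply contDiff_const

lemma integral_pd_mul {f g : (Fin d → ℝ) → ℝ} (hf : ContDiff ℝ 1 f) (hg : ContDiff ℝ 1 g)
    (hpf : ZdPeriodic f) (hpg : ZdPeriodic g) (i : Fin d) :
    ∫ x in cube d, pd i f x * g x = - ∫ x in cube d, f x * pd i g x := by
  have h := integral_cube_fderiv_eq_zero (hf.mul hg)
    (fun x k => by simp only [hpf x k, hpg x k]) i
  have hp : ∀ x, fderiv ℝ (fun y => f y * g y) x (Pi.single i 1) =
      pd i f x * g x + f x * pd i g x := fun x => by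
    rw [fderiv_fun_mul (hf.differentiable one_ne_zero x) (hg.differentiable one_ne_zero x)]
    simp [pd]
    ring
  simp only [hp] at h
  have hc1 : Continuous fun x => pd i f x * g x := (Continuous.pd hf i).mul hg.continuous
  have hc2 : Continuous fun x => f x * pd i g x := hf.continuous.mul (Continuous.pd hg i)
  rw [integral_add hc1.integrableOn_cube hc2.integrableOn_cube] at h
  linarith

lemma fCoeff_pd {f : (Fin d → ℝ) → ℝ} (hf : ContDiff ℝ 1 f) (hpf : ZdPeriodic f)
    (i : Fin d) (k : Fin d → ℤ) :
    fCoeff (pd i f) k = 2 * Real.pi * Complex.I * k i * fCoeff f k := by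
  set e : (Fin d → ℝ) → ℂ := fun x => Complex.exp (-(Complex.ofReal (2 * Real.pi) * Complex.I *
      Complex.ofReal (∑ i, (k i : ℝ) * x i))) with he
  have hlin : ∀ x : Fin d → ℝ, HasFDerivAt (fun x : Fin d → ℝ => ∑ i, (k i : ℝ) * x i)
      (∑ i, (k i : ℝ) • (ContinuousLinearMap.proj i : (Fin d → ℝ) →L[ℝ] ℝ)) x := fun x =>
    HasFDerivAt.fun_sum fun j _ => (hasFDerivAt_apply j x).const_mul _
  have hed : ∀ x, HasFDerivAt e (e x • (-((Complex.ofReal (2 * Real.pi) * Complex.I) •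
      (Complex.ofRealCLM.comp
        (∑ i, (k i : ℝ) • (ContinuousLinearMap.proj i : (Fin d → ℝ) →L[ℝ] ℝ)))))) x := fun x =>
    (((Complex.ofRealCLM.hasFDerivAt.comp x (hlin x)).const_mul
      (Complex.ofReal (2 * Real.pi) * Complex.I)).neg).cexp
  have hec : ContDiff ℝ 1 e := by
    have : ContDiff ℝ 1 fun x : Fin d → ℝ => ∑ i, (k i : ℝ) * x i :=
      ContDiff.sum fun j _ => contDiff_const.mul
        (contDiff_apply ℝ ℝ j : ContDiff ℝ 1 fun x : Fin d → ℝ => x j)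
    exact Complex.contDiff_exp.comp (ContDiff.neg (contDiff_const.mul
      (Complex.ofRealCLM.contDiff.comp this)))
  have hfc : ContDiff ℝ 1 fun x => (f x : ℂ) := Complex.ofRealCLM.contDiff.comp hf
  have heper : ∀ (x : Fin d → ℝ) (l : Fin d → ℤ), e (x + fun i => (l i : ℝ)) = e x := fun x l => by
    simp only [he]
    rw [Complex.exp_eq_exp_iff_exists_int]
    refine ⟨-∑ i, k i * l i, ?_⟩
    simp only [Pi.add_apply, mul_add, Finset.sum_add_distrib]
    push_cast
    ring
  have h := integral_cube_fderiv_eq_zero (hfc.mul hec)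
    (fun x l => by simp only [hpf x l, heper x l]) i
  have hfd : ∀ x, HasFDerivAt (fun x => (f x : ℂ)) (Complex.ofRealCLM.comp (fderiv ℝ f x)) x :=
    fun x => Complex.ofRealCLM.hasFDerivAt.comp x (hf.differentiable one_ne_zero x).hasFDerivAt
  have hp : ∀ x, fderiv ℝ (fun x => (f x : ℂ) * e x) x (Pi.single i 1) =
      (pd i f x : ℂ) * e x - 2 * Real.pi * Complex.I * k i * ((f x : ℂ) * e x) := fun x => by
    rw [((hfd x).fun_mul (hed x)).fderiv]
    simp [pd, Pi.single_apply]
    ring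
  have hc1 : Continuous fun x => (pd i f x : ℂ) * e x :=
    (Complex.continuous_ofReal.comp (Continuous.pd hf i)).mul hec.continuous
  have hc2 : Continuous fun x => (f x : ℂ) * e x := hfc.continuous.mul hec.continuous
  simp only [hp] at h
  rw [integral_sub hc1.integrableOn_cube (hc2.integrableOn_cube.const_mul _),
    integral_const_mul] at h
  exact sub_eq_zero.1 h

lemma kSq_nonneg (k : Fin d → ℤ) : 0 ≤ kSq k := Finset.sum_nonneg fun _ _ => sq_nonneg _

lemma one_le_kSq {k : Fin d → ℤ} (hk : k ≠ 0) : 1 ≤ kSq k := by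
  obtain ⟨i, hi⟩ := Function.ne_iff.1 hk
  refine le_trans ?_ (Finset.single_le_sum (f := fun i => ((k i : ℝ)) ^ 2)
    (fun j _ => sq_nonneg _) (Finset.mem_univ i))
  rw [← sq_abs]
  have : (1 : ℝ) ≤ |(k i : ℝ)| := by exact_mod_cast Int.one_le_abs hi
  nlinarith

lemma hasSum_kSq_mul {f : (Fin d → ℝ) → ℝ} (hf : ContDiff ℝ 1 f) (hpf : ZdPeriodic f) :
    HasSum (fun k => 4 * Real.pi ^ 2 * kSq k * ‖fCoeff f k‖ ^ 2)
      (∑ i, ∫ x in cube d, pd i f x ^ 2) := by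
  refine (hasSum_sum fun i (_ : i ∈ Finset.univ) =>
    hasSum_sq_fCoeff (Continuous.pd hf i)).congr_fun fun k => ?_
  simp only [fCoeff_pd hf hpf, norm_mul, mul_pow, ← Finset.sum_mul, kSq, Finset.mul_sum]
  congr 1
  refine Finset.sum_congr rfl fun i _ => ?_
  simp only [RCLike.norm_ofNat, Complex.norm_real, Complex.norm_I, Complex.norm_intCast,
    Real.norm_eq_abs, sq_abs, one_pow, mul_one]
  ring

lemma hasSum_sobSq_one {f : (Fin d → ℝ) → ℝ} (hf : ContDiff ℝ 1 f) (hpf : ZdPeriodic f) :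
    HasSum (fun k => (1 + kSq k) ^ (1 : ℝ) * ‖fCoeff f k‖ ^ 2)
      ((∫ x in cube d, f x ^ 2) +
        1 / (4 * Real.pi ^ 2) * ∑ i, ∫ x in cube d, pd i f x ^ 2) := by
  refine ((hasSum_sq_fCoeff hf.continuous).add
    ((hasSum_kSq_mul hf hpf).mul_left (1 / (4 * Real.pi ^ 2)))).congr_fun fun k => ?_
  have := Real.pi_pos
  rw [Real.rpow_one]
  field_simp

lemma sobSq_one {f : (Fin d → ℝ) → ℝ} (hf : ContDiff ℝ 1 f) (hpf : ZdPeriodic f) :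
    sobSq 1 f = (∫ x in cube d, f x ^ 2) +
        1 / (4 * Real.pi ^ 2) * ∑ i, ∫ x in cube d, pd i f x ^ 2 :=
  (hasSum_sobSq_one hf hpf).tsum_eq

/-- **Poincaré inequality** on the torus. -/
lemma integral_sq_le_of_integral_eq_zero {f : (Fin d → ℝ) → ℝ} (hf : ContDiff ℝ 1 f)
    (hpf : ZdPeriodic f) (h0 : ∫ x in cube d, f x = 0) :
    4 * Real.pi ^ 2 * ∫ x in cube d, f x ^ 2 ≤ ∑ i, ∫ x in cube d, pd i f x ^ 2 := by
  refine hasSum_le (fun k => ?_) ((hasSum_sq_fCoeff hf.continuous).mul_left (4 * Real.pi ^ 2))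
    (hasSum_kSq_mul hf hpf)
  by_cases hk : k = 0
  · have : fCoeff f k = 0 := by
      simp only [fCoeff, hk]
      simp [integral_complex_ofReal, h0]
    simp [this]
  · have := one_le_kSq hk
    have := Real.pi_pos
    refine mul_le_mul_of_nonneg_right ?_ (sq_nonneg _)
    nlinarith [sq_nonneg Real.pi]

lemma sobSq_summable_neg_one {f : (Fin d → ℝ) → ℝ} (hf : Continuous f) :
    Summable (fun k => (1 + kSq k) ^ (-1 : ℝ) * ‖fCoeff f k‖ ^ 2) := by
  refine Summable.of_nonneg_of_le (fun k => ?_) (fun k => ?_) (hasSum_sq_fCoeff hf).summable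
  · have := kSq_nonneg k
    positivity
  · have := kSq_nonneg k
    refine mul_le_of_le_one_left (sq_nonneg _) ?_
    rw [Real.rpow_neg_one]
    exact inv_le_one_of_one_le₀ (by linarith)

lemma sobSq_nonneg (s : ℝ) (f : (Fin d → ℝ) → ℝ) : 0 ≤ sobSq s f :=
  tsum_nonneg fun k => by
    have := kSq_nonneg k
    positivity

lemma sobSq_neg_one_le {f : (Fin d → ℝ) → ℝ} (hf : Continuous f) :
    sobSq (-1) f ≤ ∫ x in cube d, f x ^ 2 := by
  rw [← (hasSum_sq_fCoeff hf).tsum_eq]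
  refine (sobSq_summable_neg_one hf).tsum_le_tsum (fun k => ?_) (hasSum_sq_fCoeff hf).summable
  have := kSq_nonneg k
  refine mul_le_of_le_one_left (sq_nonneg _) ?_
  rw [Real.rpow_neg_one]
  exact inv_le_one_of_one_le₀ (by linarith)

/-- Duality between `H⁻¹` and `H¹`, in the form of a weighted Young inequality. -/
lemma abs_integral_mul_le_sobSq {f g : (Fin d → ℝ) → ℝ} (hf : Continuous f)
    (hg : ContDiff ℝ 1 g) (hpg : ZdPeriodic g) {a b : ℝ} (ha : 0 < a) (hab : 1 ≤ 4 * a * b) :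
    |∫ x in cube d, f x * g x| ≤ a * sobSq (-1) f + b * sobSq 1 g := by
  have h := hasSum_fCoeff_mul hf hg.continuous
  have hb : HasSum (fun k => a * ((1 + kSq k) ^ (-1 : ℝ) * ‖fCoeff f k‖ ^ 2) +
      b * ((1 + kSq k) ^ (1 : ℝ) * ‖fCoeff g k‖ ^ 2)) (a * sobSq (-1) f + b * sobSq 1 g) :=
    ((sobSq_summable_neg_one hf).hasSum.mul_left a).add
      ((hasSum_sobSq_one hg hpg).summable.hasSum.mul_left b)
  rw [← Real.norm_eq_abs, ← Complex.norm_real, ← h.tsum_eq]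
  refine tsum_of_norm_bounded hb fun k => ?_
  have hk : 0 < 1 + kSq k := by linarith [kSq_nonneg k]
  rw [norm_mul, RCLike.norm_conj, Real.rpow_one, Real.rpow_neg_one]
  set x := ‖fCoeff f k‖
  set y := ‖fCoeff g k‖
  set w := 1 + kSq k
  have hx : x = w * (w⁻¹ * x) := by field_simp
  have e1 : a * (w⁻¹ * x ^ 2) = w * (a * (w⁻¹ * x) ^ 2) := by field_simp
  have e2 : x * y = w * ((w⁻¹ * x) * y) := by field_simp
  rw [e1, e2]
  have : (w⁻¹ * x) * y ≤ a * (w⁻¹ * x) ^ 2 + b * y ^ 2 := by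
    set z := w⁻¹ * x
    have h1 : 0 ≤ (2 * a * z - y) ^ 2 := sq_nonneg _
    have h2 : y ^ 2 ≤ 4 * a * b * y ^ 2 := le_mul_of_one_le_left (sq_nonneg y) hab
    have h3 : 0 ≤ 4 * a * (a * z ^ 2 + b * y ^ 2 - z * y) := by nlinarith
    have := nonneg_of_mul_nonneg_right h3 (by positivity)
    linarith
  calc w * (w⁻¹ * x * y) ≤ w * (a * (w⁻¹ * x) ^ 2 + b * y ^ 2) := by gcongr
    _ = _ := by ring

lemma ZdPeriodic.sub {f g : (Fin d → ℝ) → ℝ} (hf : ZdPeriodic f) (hg : ZdPeriodic g) :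
    ZdPeriodic fun x => f x - g x := fun x k => by simp only [hf x k, hg x k]

lemma ZdPeriodic.add {f g : (Fin d → ℝ) → ℝ} (hf : ZdPeriodic f) (hg : ZdPeriodic g) :
    ZdPeriodic fun x => f x + g x := fun x k => by simp only [hf x k, hg x k]

lemma ZdPeriodic.mul {f g : (Fin d → ℝ) → ℝ} (hf : ZdPeriodic f) (hg : ZdPeriodic g) :
    ZdPeriodic fun x => f x * g x := fun x k => by simp only [hf x k, hg x k]

lemma ZdPeriodic.pd {f : (Fin d → ℝ) → ℝ} (hf : ZdPeriodic f) (i : Fin d) :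
    ZdPeriodic (pd i f) := fun x k => by
  have h : (fun y => f (y + fun i => (k i : ℝ))) = f := funext fun y => hf y k
  unfold _root_.pd
  rw [← fderiv_comp_add_right, h]

lemma ZdPeriodic.pconv {f : (Fin d → ℝ) → ℝ} (hf : ZdPeriodic f) (g : (Fin d → ℝ) → ℝ) :
    ZdPeriodic (pconv f g) := fun x k => by
  simp only [_root_.pconv, add_sub_right_comm, hf _ k]

lemma hasFDerivAt_pconv {f g : (Fin d → ℝ) → ℝ} (hf : ContDiff ℝ 1 f) (hg : Continuous g)
    (x : Fin d → ℝ) :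
    HasFDerivAt (pconv f g) (∫ y in cube d, g y • fderiv ℝ f (x - y)) x := by
  have hf' := hf.continuous_fderiv one_ne_zero
  have hc : Continuous fun z : (Fin d → ℝ) × (Fin d → ℝ) => g z.2 • fderiv ℝ f (z.1 - z.2) :=
    (hg.comp continuous_snd).smul (hf'.comp (continuous_fst.sub continuous_snd))
  obtain ⟨C, hC⟩ := ((isCompact_closedBall x 1).prod
    (isCompact_Icc (a := (0 : Fin d → ℝ)) (b := 1))).exists_bound_of_continuousOn hc.continuousOn
  have hcx : ∀ x, Continuous fun y => f (x - y) * g y := fun x =>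
    (hf.continuous.comp (continuous_const.sub continuous_id)).mul hg
  refine hasFDerivAt_integral_of_dominated_of_fderiv_le
    (F := fun x y => f (x - y) * g y) (F' := fun x y => g y • fderiv ℝ f (x - y))
    (bound := fun _ => C) (Metric.closedBall_mem_nhds x one_pos) ?_ ?_ ?_ ?_ ?_ ?_
  · exact Filter.Eventually.of_forall fun x => (hcx x).aestronglyMeasurable
  · exact (hcx x).integrableOn_cube
  · exact (hc.comp (continuous_const.prodMk continuous_id)).aestronglyMeasurable
  · rw [restrict_cube]
    filter_upwards [ae_restrict_mem measurableSet_Icc] with y hy z hz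
    exact hC (z, y) ⟨hz, hy⟩
  · exact integrable_const C
  · refine Filter.Eventually.of_forall fun y z _ => ?_
    have h1 : HasFDerivAt (fun z => f (z - y)) (fderiv ℝ f (z - y)) z := by
      rw [hasFDerivAt_comp_sub]
      exact (hf.differentiable one_ne_zero _).hasFDerivAt
    exact h1.mul_const (g y)

lemma contDiff_pconv {f g : (Fin d → ℝ) → ℝ} (hf : ContDiff ℝ 1 f) (hg : Continuous g) :
    ContDiff ℝ 1 (pconv f g) := by
  refine contDiff_one_iff_hasFDerivAt.2 ⟨_, ?_, hasFDerivAt_pconv hf hg⟩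
  have hc : Continuous (Function.uncurry fun x y => g y • fderiv ℝ f (x - y)) :=
    (hg.comp continuous_snd).smul
      ((hf.continuous_fderiv one_ne_zero).comp (continuous_fst.sub continuous_snd))
  have := continuous_parametric_integral_of_continuous (μ := volume) hc
    (isCompact_Icc (a := (0 : Fin d → ℝ)) (b := 1))
  simpa only [← restrict_cube] using! this

lemma pd_pconv {f g : (Fin d → ℝ) → ℝ} (hf : ContDiff ℝ 1 f) (hg : Continuous g) (i : Fin d) :
    pd i (pconv f g) = pconv (pd i f) g := by
  ext x
  have hc : Continuous fun y => g y • fderiv ℝ f (x - y) :=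
    hg.smul ((hf.continuous_fderiv one_ne_zero).comp (continuous_const.sub continuous_id))
  rw [pd, (hasFDerivAt_pconv hf hg x).fderiv,
    ContinuousLinearMap.integral_apply hc.integrableOn_cube]
  simp only [pconv, pd, _root_.smul_apply, smul_eq_mul, mul_comm]

lemma abs_pconv_le {f g : (Fin d → ℝ) → ℝ} (hg : Continuous g) {M : ℝ}
    (hM : ∀ x, |f x| ≤ M) (x : Fin d → ℝ) :
    |pconv f g x| ≤ M * ∫ y in cube d, |g y| := by
  rw [← integral_const_mul, ← Real.norm_eq_abs]
  refine norm_integral_le_of_norm_le (hg.abs.integrableOn_cube.const_mul M)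
    (Filter.Eventually.of_forall fun y => ?_)
  rw [norm_mul, Real.norm_eq_abs, Real.norm_eq_abs]
  exact mul_le_mul_of_nonneg_right (hM _) (abs_nonneg _)

lemma sq_integral_abs_le {f : (Fin d → ℝ) → ℝ} (hf : Continuous f) :
    (∫ x in cube d, |f x|) ^ 2 ≤ ∫ x in cube d, f x ^ 2 := by
  set m := ∫ x in cube d, |f x| with hm
  have h : ∫ x in cube d, (2 * m * |f x| - m ^ 2) ≤ ∫ x in cube d, f x ^ 2 := by
    refine integral_mono ((continuous_const.mul hf.abs).sub continuous_const).integrableOn_cube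
      (hf.pow 2).integrableOn_cube fun x => ?_
    have := sq_nonneg (|f x| - m)
    have := sq_abs (f x)
    dsimp only
    nlinarith
  rw [integral_sub (hf.abs.integrableOn_cube.const_mul _) (integrable_const _),
    integral_const_mul, ← hm, integral_const] at h
  simp only [probReal_univ, one_smul] at h
  linarith

lemma integral_cube_comp_sub {f : (Fin d → ℝ) → ℝ} (hf : ContDiff ℝ 1 f) (hpf : ZdPeriodic f)
    (y : Fin d → ℝ) : ∫ x in cube d, f (x - y) = ∫ x in cube d, f x := by
  set r : (Fin d → ℝ) → ℝ := fun z => f (-z) with hr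
  have hrc : ContDiff ℝ 1 r := hf.comp contDiff_neg
  have hpr : ZdPeriodic r := fun x k => by
    have := hpf (-x - fun i => (k i : ℝ)) k
    simp only [sub_add_cancel] at this
    simp only [hr, this, neg_add']
  have hrep : ∀ y, pconv r (fun _ => 1) y = ∫ x in cube d, f (x - y) := fun y => by
    simp [pconv, hr]
  have hder : ∀ y, fderiv ℝ (pconv r fun _ => 1) y = 0 := fun y => by
    refine ContinuousLinearMap.coe_injective (LinearMap.pi_ext' fun i => LinearMap.ext_ring ?_)
    change pd i (pconv r fun _ => 1) y = 0
    rw [pd_pconv hrc continuous_const]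
    have h := integral_cube_fderiv_eq_zero (F := fun x => r (y - x))
      (hrc.comp (contDiff_const.sub contDiff_id)) (fun x k => by
        have := hpr (y - (x + fun i => (k i : ℝ))) k
        rw [← sub_sub, sub_add_cancel] at this
        rw [← sub_sub, this]) i
    have hneg : ∀ x, fderiv ℝ (fun x => r (y - x)) x (Pi.single i 1) =
        -fderiv ℝ r (y - x) (Pi.single i 1) := fun x => by
      have h' : HasFDerivAt (fun x => r (y - x)) _ x :=
        ((hrc.differentiable one_ne_zero (y - x)).hasFDerivAt).comp x
          ((hasFDerivAt_id x).const_sub y)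
      rw [h'.fderiv]
      simp
    simp only [hneg] at h
    simp only [pconv, pd, mul_one]
    simpa [integral_neg] using h
  have := is_const_of_fderiv_eq_zero
    ((contDiff_pconv hrc continuous_const).differentiable one_ne_zero) hder y 0
  rw [hrep, hrep] at this
  simpa using this

lemma integral_pconv_eq_zero {f g : (Fin d → ℝ) → ℝ} (hf : ContDiff ℝ 1 f) (hpf : ZdPeriodic f)
    (hg : Continuous g) (h0 : ∫ x in cube d, f x = 0) : ∫ x in cube d, pconv f g x = 0 := by
  have hc : Continuous fun z : (Fin d → ℝ) × (Fin d → ℝ) => f (z.1 - z.2) * g z.2 :=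
    (hf.continuous.comp (continuous_fst.sub continuous_snd)).mul (hg.comp continuous_snd)
  have hinteg : Integrable (Function.uncurry fun x y => f (x - y) * g y)
      ((volume.restrict (cube d)).prod (volume.restrict (cube d))) := by
    rw [restrict_cube, Measure.prod_restrict]
    exact hc.continuousOn.integrableOn_compact (isCompact_Icc.prod isCompact_Icc)
  unfold pconv
  rw [integral_integral_swap hinteg]
  simp only [integral_mul_const, integral_cube_comp_sub hf hpf, h0, zero_mul, integral_zero]

lemma pconv_sub_left {f g h : (Fin d → ℝ) → ℝ} (hf : Continuous f) (hg : Continuous g)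
    (hh : Continuous h) (x : Fin d → ℝ) :
    pconv (fun y => f y - g y) h x = pconv f h x - pconv g h x := by
  have hc : ∀ {f : (Fin d → ℝ) → ℝ}, Continuous f → Continuous fun y => f (x - y) * h y :=
    fun hf => (hf.comp (continuous_const.sub continuous_id)).mul hh
  unfold pconv
  rw [← integral_sub (hc hf).integrableOn_cube (hc hg).integrableOn_cube]
  simp only [sub_mul]

lemma pconv_sub_right {f g h : (Fin d → ℝ) → ℝ} (hf : Continuous f) (hg : Continuous g)
    (hh : Continuous h) (x : Fin d → ℝ) :
    pconv f (fun y => g y - h y) x = pconv f g x - pconv f h x := by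
  have hc : ∀ {g : (Fin d → ℝ) → ℝ}, Continuous g → Continuous fun y => f (x - y) * g y :=
    fun hg => (hf.comp (continuous_const.sub continuous_id)).mul hg
  unfold pconv
  rw [← integral_sub (hc hg).integrableOn_cube (hc hh).integrableOn_cube]
  simp only [mul_sub]

lemma pd_sub {f g : (Fin d → ℝ) → ℝ} (hf : ContDiff ℝ 1 f) (hg : ContDiff ℝ 1 g) (i : Fin d)
    (x : Fin d → ℝ) : pd i (fun y => f y - g y) x = pd i f x - pd i g x := by
  simp only [pd]
  rw [fderiv_fun_sub (hf.differentiable one_ne_zero x) (hg.differentiable one_ne_zero x)]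
  simp

lemma pd_add {f g : (Fin d → ℝ) → ℝ} (hf : ContDiff ℝ 1 f) (hg : ContDiff ℝ 1 g) (i : Fin d)
    (x : Fin d → ℝ) : pd i (fun y => f y + g y) x = pd i f x + pd i g x := by
  simp only [pd]
  rw [fderiv_fun_add (hf.differentiable one_ne_zero x) (hg.differentiable one_ne_zero x)]
  simp

/-- The constant in the stability estimate at a fixed time. -/
def stabilityConst (d : ℕ) (M lam : ℝ) : ℝ :=
  4 / lam * (1 / lam + 2 / lam * (4 * Real.pi ^ 2) + d * M ^ 2 * (2 / lam + 1))

lemma stabilityConst_pos (d : ℕ) (M : ℝ) {lam : ℝ} (hlam : 0 < lam) :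
    0 < stabilityConst d M lam := by
  have := Real.pi_pos
  unfold stabilityConst
  positivity

lemma IsProbDensity.integral_abs {f : (Fin d → ℝ) → ℝ} (hf : IsProbDensity f) :
    ∫ x in cube d, |f x| = 1 := by
  simp only [abs_of_nonneg (hf.2.1 _), hf.2.2]

lemma integral_pd_sq_le_sobSq {f : (Fin d → ℝ) → ℝ} (hf : ContDiff ℝ 1 f) (hpf : ZdPeriodic f) :
    ∑ i, ∫ x in cube d, pd i f x ^ 2 ≤ 4 * Real.pi ^ 2 * sobSq 1 f := by
  have := Real.pi_pos
  have h0 : 0 ≤ ∫ x in cube d, f x ^ 2 := integral_nonneg fun x => sq_nonneg _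
  rw [sobSq_one hf hpf, mul_add, ← mul_assoc, mul_one_div_cancel (by positivity), one_mul]
  exact le_add_of_nonneg_left (by positivity)

lemma integral_sq_le_sobSq {f : (Fin d → ℝ) → ℝ} (hf : ContDiff ℝ 1 f) (hpf : ZdPeriodic f) :
    ∫ x in cube d, f x ^ 2 ≤ sobSq 1 f := by
  have := Real.pi_pos
  have h0 : 0 ≤ ∑ i, ∫ x in cube d, pd i f x ^ 2 :=
    Finset.sum_nonneg fun i _ => integral_nonneg fun x => sq_nonneg _
  rw [sobSq_one hf hpf]
  exact le_add_of_nonneg_right (by positivity)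

lemma sobSq_one_le_of_integral_eq_zero {f : (Fin d → ℝ) → ℝ} (hf : ContDiff ℝ 1 f)
    (hpf : ZdPeriodic f) (h0 : ∫ x in cube d, f x = 0) :
    sobSq 1 f ≤ ∑ i, ∫ x in cube d, pd i f x ^ 2 := by
  have hG : 0 ≤ ∑ i, ∫ x in cube d, pd i f x ^ 2 :=
    Finset.sum_nonneg fun i _ => integral_nonneg fun x => sq_nonneg _
  have hP := integral_sq_le_of_integral_eq_zero hf hpf h0
  have hpi : 2 ≤ 4 * Real.pi ^ 2 := by nlinarith [Real.pi_gt_three]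
  rw [sobSq_one hf hpf]
  set G := ∑ i, ∫ x in cube d, pd i f x ^ 2
  set c := 4 * Real.pi ^ 2
  have h1 : ∫ x in cube d, f x ^ 2 ≤ 1 / c * G := by
    rw [one_div, ← div_eq_inv_mul, le_div_iff₀ (by linarith)]
    linarith
  have h2 : 1 / c * G ≤ 1 / 2 * G :=
    mul_le_mul_of_nonneg_right (one_div_le_one_div_of_le two_pos hpi) hG
  linarith

/-- The energy estimate behind the stability inequality: `X` is the difference of two fluxes,
decomposed according to `X = ∂u + u A + q (A - c) + q (c - e)`. -/
lemma flux_pointwise_bound {lam M m q u du A c e X : ℝ} (hlam : 0 < lam) (hq : lam ≤ q)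
    (hX : X = du + u * A + q * (A - c) + q * (c - e))
    (hA : |A| ≤ M) (hAc : |A - c| ≤ M * m) :
    lam / 2 * (c - e) ^ 2 ≤
      X * (c - e) + 2 / lam * du ^ 2 + 2 / lam * M ^ 2 * u ^ 2 + M ^ 2 * m ^ 2 * q := by
  have young : ∀ z g : ℝ, -(z * g) ≤ 2 / lam * z ^ 2 + lam / 8 * g ^ 2 := fun z g => by
    have h : 2 / lam * z ^ 2 + lam / 8 * g ^ 2 + z * g
        = 2 / lam * (z + lam / 4 * g) ^ 2 := by
      field_simp
      ring
    have : 0 ≤ 2 / lam * (z + lam / 4 * g) ^ 2 := by positivity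
    linarith
  set g := c - e
  set b := A - c
  have hq0 : 0 < q := hlam.trans_le hq
  have h1 := young du g
  have h2 := young (u * A) g
  have hA2 : A ^ 2 ≤ M ^ 2 := sq_le_sq' (abs_le.1 hA).1 (abs_le.1 hA).2
  have hb2 : b ^ 2 ≤ M ^ 2 * m ^ 2 := by
    rw [← mul_pow]
    exact sq_le_sq' (abs_le.1 hAc).1 (abs_le.1 hAc).2
  have h3 : 2 / lam * (u * A) ^ 2 ≤ 2 / lam * M ^ 2 * u ^ 2 := by
    rw [mul_pow, mul_assoc, mul_comm (u ^ 2)]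
    gcongr
  have h4 : -(q * b * g) ≤ q * (M ^ 2 * m ^ 2) + q * (g ^ 2 / 4) := by
    have : 0 ≤ q * (b + g / 2) ^ 2 := by positivity
    have : q * b ^ 2 ≤ q * (M ^ 2 * m ^ 2) := by gcongr
    nlinarith
  have h5 : lam * g ^ 2 ≤ q * g ^ 2 := by gcongr
  have hXg : X * g = du * g + u * A * g + q * b * g + q * g ^ 2 := by
    rw [hX]
    ring
  nlinarith

/-- Stability estimate at a fixed time: `D` is the difference of the right-hand sides of the two
McKean–Vlasov equations. -/
lemma integral_pconv_sq_le {M lam : ℝ} (hlam : 0 < lam) {W W₀ p q D : (Fin d → ℝ) → ℝ}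
    (hW : ContDiff ℝ 2 W) (hpW : ZdPeriodic W) (hW₀ : ContDiff ℝ 2 W₀) (hpW₀ : ZdPeriodic W₀)
    (hWM : C2NormLE W M) (hmean : ∫ x in cube d, (W x - W₀ x) = 0)
    (hp : ContDiff ℝ 2 p) (hq : ContDiff ℝ 2 q) (hpp : IsProbDensity p) (hpq : IsProbDensity q)
    (hlow : ∀ x, lam ≤ q x) (hDc : Continuous D)
    (hD : ∀ x, D x = (lap p x + divg (fun y i => p y * pd i (pconv W p) y) x) -
      (lap q x + divg (fun y i => q y * pd i (pconv W₀ q) y) x)) :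
    ∫ x in cube d, pconv (fun y => W y - W₀ y) q x ^ 2 ≤
      stabilityConst d M lam * (sobSq (-1) D + sobSq 1 fun x => p x - q x) := by
  have h12 : (1 : WithTop ℕ∞) ≤ 2 := by norm_num
  have hW1 := hW.of_le h12
  have hW₀1 := hW₀.of_le h12
  have hp1 := hp.of_le h12
  have hq1 := hq.of_le h12
  set u : (Fin d → ℝ) → ℝ := fun x => p x - q x with hu
  have hu1 : ContDiff ℝ 1 u := hp1.sub hq1
  have hpu : ZdPeriodic u := hpp.1.sub hpq.1
  set m : ℝ := ∫ x in cube d, |u x|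
  set A : Fin d → (Fin d → ℝ) → ℝ := fun i => pconv (pd i W) p
  set c : Fin d → (Fin d → ℝ) → ℝ := fun i => pconv (pd i W) q
  set e : Fin d → (Fin d → ℝ) → ℝ := fun i => pconv (pd i W₀) q
  have hAc : ∀ i, ContDiff ℝ 1 (A i) := fun i => contDiff_pconv (hW.pd i) hp.continuous
  have hec : ∀ i, ContDiff ℝ 1 (e i) := fun i => contDiff_pconv (hW₀.pd i) hq.continuous
  set g := pconv (fun y => W y - W₀ y) q with hg
  have hg1 : ContDiff ℝ 1 g := contDiff_pconv (hW1.sub hW₀1) hq.continuous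
  have hpg : ZdPeriodic g := (hpW.sub hpW₀).pconv q
  have hg0 : ∫ x in cube d, g x = 0 :=
    integral_pconv_eq_zero (hW1.sub hW₀1) (hpW.sub hpW₀) hq.continuous hmean
  have hgi : ∀ i x, pd i g x = c i x - e i x := fun i x => by
    rw [hg, pd_pconv (hW1.sub hW₀1) hq.continuous]
    have : pd i (fun y => W y - W₀ y) = fun y => pd i W y - pd i W₀ y :=
      funext fun y => pd_sub hW1 hW₀1 i y
    rw [this, pconv_sub_left (Continuous.pd hW1 i) (Continuous.pd hW₀1 i) hq.continuous]
  have hgic : ∀ i, Continuous (pd i g) := Continuous.pd hg1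
  set X : Fin d → (Fin d → ℝ) → ℝ := fun i x =>
    (pd i p x + p x * A i x) - (pd i q x + q x * e i x) with hX
  have hX1 : ∀ i, ContDiff ℝ 1 (X i) := fun i =>
    ((hp.pd i).add (hp1.mul (hAc i))).sub ((hq.pd i).add (hq1.mul (hec i)))
  have hpX : ∀ i, ZdPeriodic (X i) := fun i =>
    ((hpp.1.pd i).add (hpp.1.mul ((hpW.pd i).pconv p))).sub
      ((hpq.1.pd i).add (hpq.1.mul ((hpW₀.pd i).pconv q)))
  have hDX : ∀ x, D x = ∑ i, pd i (X i) x := fun x => by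
    rw [hD]
    simp only [lap, divg, pd_pconv hW1 hp.continuous, pd_pconv hW₀1 hq.continuous,
      ← Finset.sum_add_distrib, ← Finset.sum_sub_distrib]
    refine Finset.sum_congr rfl fun i _ => ?_
    rw [hX, pd_sub ((hp.pd i).add (hp1.mul (hAc i))) ((hq.pd i).add (hq1.mul (hec i))),
      pd_add (hp.pd i) (hp1.mul (hAc i)), pd_add (hq.pd i) (hq1.mul (hec i))]
  have hDg : ∫ x in cube d, D x * g x = -∑ i, ∫ x in cube d, X i x * pd i g x := by
    simp only [hDX, Finset.sum_mul]
    have hinteg : ∀ i, IntegrableOn (fun x => pd i (X i) x * g x) (cube d) := fun i =>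
      ((Continuous.pd (hX1 i) i).mul hg1.continuous).integrableOn_cube
    rw [integral_finsetSum _ fun i _ => hinteg i, ← Finset.sum_neg_distrib]
    exact Finset.sum_congr rfl fun i _ => integral_pd_mul (hX1 i) hg1 (hpX i) hpg i
  have hAM : ∀ i x, |A i x| ≤ M := fun i x => by
    have := abs_pconv_le hp.continuous (fun x => (hWM x).2.1 i) x
    rwa [hpp.integral_abs, mul_one] at this
  have hAcM : ∀ i x, |A i x - c i x| ≤ M * m := fun i x => by
    rw [← pconv_sub_right (Continuous.pd hW1 i) hp.continuous hq.continuous]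
    exact abs_pconv_le hu1.continuous (fun x => (hWM x).2.1 i) x
  have hstep : ∀ i, lam / 2 * ∫ x in cube d, pd i g x ^ 2 ≤
      (∫ x in cube d, X i x * pd i g x) + 2 / lam * (∫ x in cube d, pd i u x ^ 2) +
        2 / lam * M ^ 2 * (∫ x in cube d, u x ^ 2) + M ^ 2 * m ^ 2 := fun i => by
    have i1 : IntegrableOn (fun x => X i x * pd i g x) (cube d) :=
      ((hX1 i).continuous.mul (hgic i)).integrableOn_cube
    have i2 : IntegrableOn (fun x => 2 / lam * pd i u x ^ 2) (cube d) :=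
      (continuous_const.mul ((Continuous.pd hu1 i).pow 2)).integrableOn_cube
    have i3 : IntegrableOn (fun x => 2 / lam * M ^ 2 * u x ^ 2) (cube d) :=
      (continuous_const.mul (hu1.continuous.pow 2)).integrableOn_cube
    have i4 : IntegrableOn (fun x => M ^ 2 * m ^ 2 * q x) (cube d) :=
      (continuous_const.mul hq.continuous).integrableOn_cube
    have i12 : IntegrableOn (fun x => X i x * pd i g x + 2 / lam * pd i u x ^ 2) (cube d) :=
      i1.add i2
    have i123 : IntegrableOn (fun x => X i x * pd i g x + 2 / lam * pd i u x ^ 2 +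
        2 / lam * M ^ 2 * u x ^ 2) (cube d) := i12.add i3
    have h : ∫ x in cube d, lam / 2 * pd i g x ^ 2 ≤ ∫ x in cube d,
        (X i x * pd i g x + 2 / lam * pd i u x ^ 2 + 2 / lam * M ^ 2 * u x ^ 2 +
          M ^ 2 * m ^ 2 * q x) := by
      refine integral_mono (continuous_const.mul ((hgic i).pow 2)).integrableOn_cube
        (i123.add i4) fun x => ?_
      dsimp only
      rw [hgi]
      refine flux_pointwise_bound hlam (hlow x) ?_ (hAM i x) (hAcM i x)
      rw [hu, pd_sub hp1 hq1]
      ring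
    rw [integral_add i123 i4, integral_add i12 i3, integral_add i1 i2] at h
    simpa only [integral_const_mul, hpq.2.2, mul_one] using h
  have hsum := Finset.sum_le_sum fun i (_ : i ∈ Finset.univ) => hstep i
  simp only [← Finset.mul_sum, Finset.sum_add_distrib, Finset.sum_const, Finset.card_univ,
    Fintype.card_fin, nsmul_eq_mul] at hsum
  have hdual := abs_integral_mul_le_sobSq hDc hg1 hpg (a := 1 / lam) (b := lam / 4)
    (by positivity) (by field_simp; norm_num)
  rw [hDg, abs_neg] at hdual
  have hXle := (le_abs_self _).trans hdual
  have hSg := sobSq_one_le_of_integral_eq_zero hg1 hpg hg0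
  have hgS := integral_sq_le_sobSq hg1 hpg
  have hU := integral_pd_sq_le_sobSq hu1 hpu
  have hu2 := integral_sq_le_sobSq hu1 hpu
  have hm := sq_integral_abs_le hu1.continuous
  have hSm := sobSq_nonneg (-1) D
  have hS1 := sobSq_nonneg 1 u
  set G := ∑ i, ∫ x in cube d, pd i g x ^ 2
  set U := ∑ i, ∫ x in cube d, pd i u x ^ 2
  set Sm := sobSq (-1) D
  set S1 := sobSq 1 u
  set N := ∫ x in cube d, u x ^ 2
  have e1 : lam / 4 * sobSq 1 g ≤ lam / 4 * G := by gcongr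
  have e2 : 2 / lam * U ≤ 2 / lam * (4 * Real.pi ^ 2 * S1) := by gcongr
  have e3 : (d : ℝ) * (2 / lam * M ^ 2 * N) ≤ d * (2 / lam * M ^ 2 * S1) := by gcongr
  have e4 : (d : ℝ) * (M ^ 2 * m ^ 2) ≤ d * (M ^ 2 * S1) := by
    gcongr
    exact hm.trans hu2
  have hmain : lam / 4 * G ≤
      (1 / lam + 2 / lam * (4 * Real.pi ^ 2) + d * M ^ 2 * (2 / lam + 1)) * (Sm + S1) := by
    have f1 : 0 ≤ (2 / lam * (4 * Real.pi ^ 2) + d * M ^ 2 * (2 / lam + 1)) * Sm := by positivity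
    have f2 : 0 ≤ 1 / lam * S1 := by positivity
    linarith
  calc ∫ x in cube d, g x ^ 2 ≤ G := hgS.trans hSg
    _ = 4 / lam * (lam / 4 * G) := by field_simp
    _ ≤ 4 / lam * ((1 / lam + 2 / lam * (4 * Real.pi ^ 2) + d * M ^ 2 * (2 / lam + 1)) *
          (Sm + S1)) := by gcongr
    _ = _ := by rw [stabilityConst]; ring

section TimeDependent

variable {T : ℝ} {h : ℝ → (Fin d → ℝ) → ℝ}

lemma ContinuousOn.continuous_slice {I : Set ℝ} {F : Type*} [TopologicalSpace F]
    {f : ℝ × (Fin d → ℝ) → F} (hf : ContinuousOn f (I ×ˢ Set.univ)) {t : ℝ} (ht : t ∈ I) :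
    Continuous fun x => f (t, x) :=
  hf.comp_continuous (by fun_prop) fun _ => ⟨ht, Set.mem_univ _⟩

lemma aestronglyMeasurable_fCoeff {I : Set ℝ} (hI : MeasurableSet I)
    (hh : ContinuousOn (Function.uncurry h) (I ×ˢ Set.univ)) (k : Fin d → ℤ) :
    AEStronglyMeasurable (fun t => fCoeff (h t) k) (volume.restrict I) := by
  have hc : ContinuousOn (fun p : ℝ × (Fin d → ℝ) => Complex.ofReal (Function.uncurry h p) *
      Complex.exp (-(Complex.ofReal (2 * Real.pi) * Complex.I *
        Complex.ofReal (∑ i, (k i : ℝ) * p.2 i)))) (I ×ˢ cube d) := by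
    refine ContinuousOn.mul ?_ (Continuous.continuousOn (by fun_prop))
    exact Complex.continuous_ofReal.comp_continuousOn
      (hh.mono (Set.prod_mono_right (Set.subset_univ _)))
  have hm := hc.aestronglyMeasurable (μ := volume.prod volume) (hI.prod measurableSet_cube)
  rw [← Measure.prod_restrict] at hm
  exact hm.integral_prod_right'

lemma aestronglyMeasurable_sobSq {I : Set ℝ} (hI : MeasurableSet I)
    (hh : ContinuousOn (Function.uncurry h) (I ×ˢ Set.univ)) (s : ℝ) :
    AEStronglyMeasurable (fun t => sobSq s (h t)) (volume.restrict I) := by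
  have hm : ∀ k : Fin d → ℤ, AEMeasurable
      (fun t => ENNReal.ofReal ((1 + kSq k) ^ s * ‖fCoeff (h t) k‖ ^ 2)) (volume.restrict I) :=
    fun k => (((aestronglyMeasurable_fCoeff hI hh k).norm.aemeasurable.pow_const 2).const_mul
      _).ennreal_ofReal
  refine (AEMeasurable.tsum (L := .unconditional _) hm).ennreal_toReal.aestronglyMeasurable.congr
    (Filter.Eventually.of_forall fun t => ?_)
  dsimp only
  rw [ENNReal.tsum_toReal_eq fun _ => ENNReal.ofReal_ne_top]
  refine tsum_congr fun k => ENNReal.toReal_ofReal ?_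
  have := kSq_nonneg k
  positivity

lemma exists_integral_sq_le (hh : ContinuousOn (Function.uncurry h) (Set.Icc 0 T ×ˢ Set.univ)) :
    ∃ C, ∀ t ∈ Set.Icc 0 T, ∫ x in cube d, h t x ^ 2 ≤ C := by
  obtain ⟨C, hC⟩ := (isCompact_Icc.prod
    (isCompact_Icc (a := (0 : Fin d → ℝ)) (b := 1))).exists_bound_of_continuousOn
      (hh.mono (Set.prod_mono_right (Set.subset_univ _)))
  refine ⟨C ^ 2, fun t ht => ?_⟩
  have hle : ∀ x ∈ cube d, h t x ^ 2 ≤ C ^ 2 := fun x hx => by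
    have hx' : x ∈ Set.Icc (0 : Fin d → ℝ) 1 :=
      ⟨fun i => (hx i (Set.mem_univ i)).1, fun i => (hx i (Set.mem_univ i)).2.le⟩
    have := abs_le.1 (hC (t, x) ⟨ht, hx'⟩)
    exact sq_le_sq' this.1 this.2
  refine (setIntegral_mono_on ((hh.continuous_slice ht).pow 2).integrableOn_cube
    (integrable_const _) measurableSet_cube hle).trans ?_
  simp only [integral_const, probReal_univ, one_smul, le_refl]

lemma integrableOn_sobSq_of_le
    (hh : ContinuousOn (Function.uncurry h) (Set.Icc 0 T ×ˢ Set.univ)) {s C : ℝ}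
    (hC : ∀ t ∈ Set.Icc 0 T, sobSq s (h t) ≤ C) :
    IntegrableOn (fun t => sobSq s (h t)) (Set.Icc 0 T) := by
  refine Integrable.of_bound (aestronglyMeasurable_sobSq measurableSet_Icc hh s) C ?_
  filter_upwards [ae_restrict_mem measurableSet_Icc] with t ht
  rw [Real.norm_of_nonneg (sobSq_nonneg _ _)]
  exact hC t ht

lemma integrableOn_sobSq_neg_one
    (hh : ContinuousOn (Function.uncurry h) (Set.Icc 0 T ×ˢ Set.univ)) :
    IntegrableOn (fun t => sobSq (-1) (h t)) (Set.Icc 0 T) := by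
  obtain ⟨C, hC⟩ := exists_integral_sq_le hh
  exact integrableOn_sobSq_of_le hh fun t ht =>
    (sobSq_neg_one_le (hh.continuous_slice ht)).trans (hC t ht)

lemma continuousOn_fderivWithin_strip (hT : 0 < T)
    (hh : ContDiffOn ℝ 1 (Function.uncurry h) (Set.Icc 0 T ×ˢ Set.univ)) (v : ℝ × (Fin d → ℝ)) :
    ContinuousOn (fun p => fderivWithin ℝ (Function.uncurry h) (Set.Icc 0 T ×ˢ Set.univ) p v)
      (Set.Icc 0 T ×ˢ Set.univ) :=
  (hh.continuousOn_fderivWithin ((uniqueDiffOn_Icc hT).prod uniqueDiffOn_univ) le_rfl).clm_apply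
    continuousOn_const

lemma ContDiffOn.contDiff_slice {n : WithTop ℕ∞} {I : Set ℝ}
    (hh : ContDiffOn ℝ n (Function.uncurry h) (I ×ˢ Set.univ)) {t : ℝ} (ht : t ∈ I) :
    ContDiff ℝ n (h t) :=
  contDiffOn_univ.1 (hh.comp (f := fun x => (t, x)) (by fun_prop) fun _ hx => ⟨ht, hx⟩)

lemma pd_eq_fderivWithin (hh : ContDiffOn ℝ 1 (Function.uncurry h) (Set.Icc 0 T ×ˢ Set.univ))
    {t : ℝ} (ht : t ∈ Set.Icc 0 T) (i : Fin d) (x : Fin d → ℝ) :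
    pd i (h t) x = fderivWithin ℝ (Function.uncurry h) (Set.Icc 0 T ×ˢ Set.univ) (t, x)
      (0, Pi.single i 1) := by
  have h1 := (hh.differentiableOn one_ne_zero (t, x) ⟨ht, Set.mem_univ _⟩).hasFDerivWithinAt
  have h2 : HasFDerivWithinAt (fun x => (t, x))
      (ContinuousLinearMap.inr ℝ ℝ (Fin d → ℝ)) Set.univ x :=
    (hasFDerivAt_prodMk_right t x).hasFDerivWithinAt
  have h3 := (h1.comp x h2 fun _ hx => ⟨ht, hx⟩).hasFDerivAt_of_univ
  have h4 : HasFDerivAt (h t) _ x := h3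
  rw [pd, h4.fderiv]
  rfl

lemma deriv_eq_fderivWithin
    (hh : ContDiffOn ℝ 1 (Function.uncurry h) (Set.Icc 0 T ×ˢ Set.univ))
    {t : ℝ} (ht : t ∈ Set.Ioo 0 T) (x : Fin d → ℝ) :
    deriv (fun s => h s x) t =
      fderivWithin ℝ (Function.uncurry h) (Set.Icc 0 T ×ˢ Set.univ) (t, x) (1, 0) := by
  have h1 := (hh.differentiableOn one_ne_zero (t, x)
    ⟨Set.Ioo_subset_Icc_self ht, Set.mem_univ _⟩).hasFDerivWithinAt
  have h2 : HasFDerivWithinAt (fun s => (s, x))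
      (ContinuousLinearMap.inl ℝ ℝ (Fin d → ℝ)) (Set.Icc 0 T) t :=
    (hasFDerivAt_prodMk_left t x).hasFDerivWithinAt
  have h3 := (h1.comp t h2 fun s hs => Set.mk_mem_prod hs (Set.mem_univ x)).hasFDerivAt
    (Icc_mem_nhds ht.1 ht.2)
  have h4 : HasFDerivAt (fun s => h s x) _ t := h3
  rw [h4.hasDerivAt.deriv]
  rfl

lemma integrableOn_sobSq_one (hT : 0 < T)
    (hh : ContDiffOn ℝ 1 (Function.uncurry h) (Set.Icc 0 T ×ˢ Set.univ))
    (hp : ∀ t ∈ Set.Icc 0 T, ZdPeriodic (h t)) :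
    IntegrableOn (fun t => sobSq 1 (h t)) (Set.Icc 0 T) := by
  obtain ⟨C, hC⟩ := exists_integral_sq_le hh.continuousOn
  have hd : ∀ i : Fin d, ∃ C, ∀ t ∈ Set.Icc 0 T, ∫ x in cube d, pd i (h t) x ^ 2 ≤ C :=
    fun i => by
      obtain ⟨C, hC⟩ := exists_integral_sq_le (h := fun t x =>
        fderivWithin ℝ (Function.uncurry h) (Set.Icc 0 T ×ˢ Set.univ) (t, x) (0, Pi.single i 1))
        (continuousOn_fderivWithin_strip hT hh _)
      refine ⟨C, fun t ht => ?_⟩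
      simp only [pd_eq_fderivWithin hh ht]
      exact hC t ht
  choose C' hC' using hd
  refine integrableOn_sobSq_of_le hh.continuousOn
    (C := C + 1 / (4 * Real.pi ^ 2) * ∑ i, C' i) fun t ht => ?_
  rw [sobSq_one (hh.contDiff_slice ht) (hp t ht)]
  gcongr with i
  · exact hC t ht
  · exact hC' i t ht

lemma integrableOn_sobSq_neg_one_deriv (hT : 0 < T)
    (hh : ContDiffOn ℝ 1 (Function.uncurry h) (Set.Icc 0 T ×ˢ Set.univ)) :
    IntegrableOn (fun t => sobSq (-1) fun x => deriv (fun s => h s x) t) (Set.Ioo 0 T) := by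
  have hi := (integrableOn_sobSq_neg_one (h := fun t x => fderivWithin ℝ (Function.uncurry h)
    (Set.Icc 0 T ×ˢ Set.univ) (t, x) (1, 0)) (continuousOn_fderivWithin_strip hT hh _)).mono_set
      Set.Ioo_subset_Icc_self
  refine hi.congr_fun (fun t ht => ?_) measurableSet_Ioo
  simp only [deriv_eq_fderivWithin hh ht]

lemma differentiableAt_time {x : Fin d → ℝ} {ρ : ℝ → (Fin d → ℝ) → ℝ}
    (hρ : ContDiffOn ℝ 1 (fun t => ρ t x) (Set.Icc 0 T)) {t : ℝ} (ht : t ∈ Set.Ioo 0 T) :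
    DifferentiableAt ℝ (fun s => ρ s x) t :=
  (hρ.contDiffAt (Icc_mem_nhds ht.1 ht.2)).differentiableAt one_ne_zero

end TimeDependent

/-- deconvolution-type stability estimate: the L²-in-time norm of
`(W−W₀)*ρ_{W₀}` is controlled by space-time Sobolev norms of `ρ_W − ρ_{W₀}`. -/
theorem mv_convolution_stability
    (d : ℕ) (hd : 1 ≤ d) (M T lam : ℝ) (hM : 0 < M) (hT : 0 < T) (hlam : 0 < lam) :
    ∃ C > 0, ∀ (W W₀ φ : (Fin d → ℝ) → ℝ) (ρ ρ₀ : ℝ → (Fin d → ℝ) → ℝ),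
      ContDiff ℝ 2 W → ZdPeriodic W →
      ContDiff ℝ 2 W₀ → ZdPeriodic W₀ →
      C2NormLE W M → C2NormLE W₀ M →
      (∫ x in cube d, (W x - W₀ x)) = 0 →
      IsMVSolution T W φ ρ → IsMVSolution T W₀ φ ρ₀ →
      ContDiffOn ℝ (⊤ : ℕ∞) (fun p : ℝ × (Fin d → ℝ) => ρ p.1 p.2)
        (Set.Icc (0:ℝ) T ×ˢ (Set.univ : Set (Fin d → ℝ))) →
      ContDiffOn ℝ (⊤ : ℕ∞) (fun p : ℝ × (Fin d → ℝ) => ρ₀ p.1 p.2)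
        (Set.Icc (0:ℝ) T ×ˢ (Set.univ : Set (Fin d → ℝ))) →
      (∀ t ∈ Set.Icc (0:ℝ) T, ∀ x, lam ≤ ρ₀ t x) →
      ∀ t₀, 0 < t₀ → t₀ ≤ T →
        (∫ t in Set.Ioc (0:ℝ) t₀, ∫ x in cube d,
            (pconv (fun y => W y - W₀ y) (ρ₀ t) x) ^ 2) ≤
          C * ((∫ t in Set.Ioc (0:ℝ) t₀,
                  (sobSq (-1) (fun x => ρ t x - ρ₀ t x) +
                   sobSq (-1) (fun x => deriv (fun s => ρ s x - ρ₀ s x) t))) +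
               (∫ t in Set.Ioc (0:ℝ) t₀, sobSq 1 (fun x => ρ t x - ρ₀ t x))) := by
  refine ⟨stabilityConst d M lam, stabilityConst_pos d M hlam, ?_⟩
  intro W W₀ φ ρ ρ₀ hW hpW hW₀ hpW₀ hWM _ hmean hρ hρ₀ hsm hsm₀ hlow t₀ ht₀ ht₀T
  obtain ⟨hper, htime, hspace, -, hdens, hpde⟩ := hρ
  obtain ⟨hper₀, htime₀, hspace₀, -, hdens₀, hpde₀⟩ := hρ₀
  have hu : ContDiffOn ℝ 1 (Function.uncurry fun t x => ρ t x - ρ₀ t x)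
      (Set.Icc (0:ℝ) T ×ˢ (Set.univ : Set (Fin d → ℝ))) :=
    (hsm.sub hsm₀).of_le (by exact_mod_cast le_top)
  have hsub : Set.Ioo 0 t₀ ⊆ Set.Ioo 0 T := Set.Ioo_subset_Ioo_right ht₀T
  have hsubc : Set.Ioo 0 t₀ ⊆ Set.Icc 0 T := hsub.trans Set.Ioo_subset_Icc_self
  have ha := (integrableOn_sobSq_neg_one hu.continuousOn).mono_set hsubc
  have hb := (integrableOn_sobSq_neg_one_deriv hT hu).mono_set hsub
  have hc := (integrableOn_sobSq_one hT hu fun t ht => (hper t ht).sub (hper₀ t ht)).mono_set hsubc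
  rw [integral_Ioc_eq_integral_Ioo, integral_Ioc_eq_integral_Ioo, integral_Ioc_eq_integral_Ioo]
  have hab : IntegrableOn (fun t => sobSq (-1) (fun x => ρ t x - ρ₀ t x) +
      sobSq (-1) (fun x => deriv (fun s => ρ s x - ρ₀ s x) t)) (Set.Ioo 0 t₀) := ha.add hb
  rw [← integral_add hab hc, ← integral_const_mul]
  refine integral_mono_of_nonneg
    (Filter.Eventually.of_forall fun t => integral_nonneg fun x => sq_nonneg _)
    ((hab.add hc).const_mul _) ?_
  filter_upwards [ae_restrict_mem measurableSet_Ioo] with t ht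
  have htc := hsubc ht
  have hDc : Continuous fun x => deriv (fun s => ρ s x - ρ₀ s x) t := by
    simp only [deriv_eq_fderivWithin hu (hsub ht)]
    exact (continuousOn_fderivWithin_strip hT hu _).continuous_slice htc
  refine (integral_pconv_sq_le hlam hW hpW hW₀ hpW₀ hWM hmean (hspace t htc) (hspace₀ t htc)
    (hdens t htc) (hdens₀ t htc) (hlow t htc) hDc fun x => ?_).trans ?_
  · rw [← hpde t htc x, ← hpde₀ t htc x]
    exact deriv_fun_sub (differentiableAt_time (htime x) (hsub ht))
      (differentiableAt_time (htime₀ x) (hsub ht))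
  · refine mul_le_mul_of_nonneg_left ?_ (stabilityConst_pos d M hlam).le
    have := sobSq_nonneg (-1) fun x => ρ t x - ρ₀ t x
    linarith
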